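/- Let u be a nonnegative smooth solution of the heat equation Δu = ∂_t u on ℝⁿ × (-∞, 0], and let (ν_x)_{x ∈ ℝⁿ} be a family of finite nonnegative Borel measures on [0,∞) such that u(x,-t) = ∫₀^∞ e^{-ts} dν_x(s) for all t > 0 and x ∈ ℝⁿ, and such that (x,t) ↦ ν_x([0,t]) is jointly measurable. Define h(x,t) = ν_x([0,t]). Then for each t ≥ 0 the function x ↦ h(x,t) is smooth and satisfies Δ_x h(x,t) = t·h(x,t) − ∫₀^t h(x,s) ds for all x ∈ ℝⁿ. -/

import Mathlib

open MeasureTheory Real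

noncomputable section

/-- Spatial Laplacian of `f : ℝⁿ → ℝ` at `x` (sum of second partial derivatives). -/
def lap (n : ℕ) (f : EuclideanSpace ℝ (Fin n) → ℝ) (x : EuclideanSpace ℝ (Fin n)) : ℝ :=
  ∑ i : Fin n, fderiv ℝ (fun y => fderiv ℝ f y (EuclideanSpace.single i 1)) x
    (EuclideanSpace.single i 1)

/-- `u` is a smooth ancient solution of the heat equation on `ℝⁿ × (-∞, 0]`:
it is smooth and satisfies `Δ_x u = ∂_t u` for all `t ≤ 0`. -/
def IsAncientHeat (n : ℕ) (u : EuclideanSpace ℝ (Fin n) × ℝ → ℝ) : Prop :=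
  ContDiff ℝ (⊤ : ℕ∞) u ∧ ∀ (x : EuclideanSpace ℝ (Fin n)) (t : ℝ), t ≤ 0 →
    lap n (fun y => u (y, t)) x = deriv (fun s => u (x, s)) t

section

open Filter Topology Set

variable {n : ℕ}

/-! ### The kernels `(1 - |y|²)₊ʲ / j!` -/

lemma hasDerivAt_max_zero_pow (j : ℕ) (x : ℝ) :
    HasDerivAt (fun x : ℝ => (max 0 x) ^ (j + 2)) ((j + 2) * (max 0 x) ^ (j + 1)) x := by
  rcases lt_trichotomy x 0 with hx | rfl | hx
  · rw [max_eq_left hx.le]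
    refine ((hasDerivAt_const x (0 : ℝ)).congr_of_eventuallyEq ?_).congr_deriv (by simp)
    filter_upwards [Iio_mem_nhds hx] with y hy
    simp [max_eq_left (le_of_lt (mem_Iio.1 hy))]
  · rw [hasDerivAt_iff_isLittleO]
    simp only [max_self, ne_eq, Nat.add_eq_zero_iff, one_ne_zero, and_false, not_false_eq_true,
      zero_pow, mul_zero, smul_zero, sub_zero, OfNat.ofNat_ne_zero]
    have h1 : (fun x : ℝ => (max 0 x) ^ (j + 2)) =O[𝓝 0] fun x : ℝ => x ^ (j + 2) := by
      refine Asymptotics.IsBigO.of_bound 1 (Eventually.of_forall fun y => ?_)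
      rw [norm_pow, norm_pow, one_mul]
      gcongr
      rw [Real.norm_eq_abs, Real.norm_eq_abs, abs_of_nonneg (le_max_left _ _)]
      exact max_le (abs_nonneg _) (le_abs_self _)
    refine h1.trans_isLittleO ?_
    simpa using Asymptotics.isLittleO_pow_pow (𝕜 := ℝ) (m := 1) (n := j + 2) (by omega)
  · rw [max_eq_right hx.le]
    refine ((hasDerivAt_pow (j + 2) x).congr_of_eventuallyEq ?_).congr_deriv (by push_cast; rfl)
    filter_upwards [Ioi_mem_nhds hx] with y hy
    simp [max_eq_right (le_of_lt (mem_Ioi.1 hy))]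

lemma contDiff_max_zero_pow (j : ℕ) : ContDiff ℝ j (fun x : ℝ => (max 0 x) ^ (j + 1)) := by
  induction j with
  | zero => exact contDiff_zero.2 (by fun_prop)
  | succ j ih =>
    rw [Nat.cast_succ, contDiff_succ_iff_deriv]
    refine ⟨fun x => (hasDerivAt_max_zero_pow j x).differentiableAt, by simp, ?_⟩
    rw [show deriv (fun x : ℝ => (max 0 x) ^ (j + 1 + 1))
        = fun x : ℝ => ((j : ℝ) + 2) * (max 0 x) ^ (j + 1)
      from funext fun x => (hasDerivAt_max_zero_pow j x).deriv]
    exact contDiff_const.mul ih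

/-- The compactly supported radial kernel `y ↦ (1 - |y|²)₊ʲ / j!` on `ℝⁿ`. -/
def ballKernel (j : ℕ) (y : EuclideanSpace ℝ (Fin n)) : ℝ :=
  (max 0 (1 - ‖y‖ ^ 2)) ^ j / j.factorial

lemma ballKernel_nonneg (j : ℕ) (y : EuclideanSpace ℝ (Fin n)) : 0 ≤ ballKernel j y := by
  unfold ballKernel; positivity

lemma ballKernel_le (j : ℕ) (y : EuclideanSpace ℝ (Fin n)) :
    ballKernel j y ≤ 1 / j.factorial := by
  unfold ballKernel
  gcongr
  exact pow_le_one₀ (le_max_left _ _) (max_le zero_le_one (by nlinarith [norm_nonneg y]))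

lemma ballKernel_neg (j : ℕ) (y : EuclideanSpace ℝ (Fin n)) :
    ballKernel j (-y) = ballKernel j y := by
  simp [ballKernel]

lemma ballKernel_eq_zero (j : ℕ) {y : EuclideanSpace ℝ (Fin n)} (hy : 1 ≤ ‖y‖) :
    ballKernel (j + 1) y = 0 := by
  have : max 0 (1 - ‖y‖ ^ 2) = 0 := max_eq_left (by nlinarith)
  simp [ballKernel, this]

lemma contDiff_ballKernel (j : ℕ) :
    ContDiff ℝ j (ballKernel (n := n) (j + 1)) :=
  ((contDiff_max_zero_pow j).comp (contDiff_const.sub (contDiff_norm_sq ℝ))).div_const _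

lemma continuous_ballKernel (j : ℕ) : Continuous (ballKernel (n := n) j) := by
  unfold ballKernel; fun_prop

lemma hasCompactSupport_ballKernel (j : ℕ) :
    HasCompactSupport (ballKernel (n := n) (j + 1)) := by
  refine HasCompactSupport.intro (isCompact_closedBall 0 1) fun y hy => ballKernel_eq_zero j ?_
  simp only [Metric.mem_closedBall, dist_zero_right, not_le] at hy
  exact hy.le

lemma ballKernel_mul_one_sub (j : ℕ) (y : EuclideanSpace ℝ (Fin n)) :
    (1 - ‖y‖ ^ 2) * ballKernel (j + 1) y = (j + 2) * ballKernel (j + 2) y := by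
  have h : (1 - ‖y‖ ^ 2) * (max 0 (1 - ‖y‖ ^ 2)) ^ (j + 1) = (max 0 (1 - ‖y‖ ^ 2)) ^ (j + 2) := by
    rcases le_total 0 (1 - ‖y‖ ^ 2) with h | h
    · rw [max_eq_right h]; ring
    · rw [max_eq_left h]; simp
  have h2 : ((j + 2).factorial : ℝ) = (j + 2) * (j + 1).factorial := by
    rw [Nat.factorial_succ (j + 1)]; push_cast; ring
  have h3 : ((j + 1).factorial : ℝ) ≠ 0 := by positivity
  have h4 : (j + 2 : ℝ) ≠ 0 := by positivity
  unfold ballKernel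
  rw [← mul_div_assoc, h, h2]
  field_simp

lemma norm_sq_mul_ballKernel (j : ℕ) (y : EuclideanSpace ℝ (Fin n)) :
    ‖y‖ ^ 2 * ballKernel (j + 1) y
      = ballKernel (j + 1) y - (j + 2) * ballKernel (j + 2) y := by
  linarith [ballKernel_mul_one_sub j y]

lemma fderiv_ballKernel (j : ℕ) (y v : EuclideanSpace ℝ (Fin n)) :
    fderiv ℝ (ballKernel (j + 2)) y v = -2 * inner ℝ y v * ballKernel (j + 1) y := by
  have h1 : HasFDerivAt (fun y : EuclideanSpace ℝ (Fin n) => 1 - ‖y‖ ^ 2) (-(2 • innerSL ℝ y)) y :=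
    (hasStrictFDerivAt_norm_sq y).hasFDerivAt.const_sub 1
  have h2 := ((hasDerivAt_max_zero_pow j (1 - ‖y‖ ^ 2)).comp_hasFDerivAt y h1).mul_const
    (((j + 2).factorial : ℝ)⁻¹)
  have h3 : HasFDerivAt (ballKernel (n := n) (j + 2)) _ y := h2
  rw [h3.fderiv]
  have h4 : ((j + 2).factorial : ℝ) = (j + 2) * (j + 1).factorial := by
    rw [Nat.factorial_succ (j + 1)]; push_cast; ring
  have h5 : ((j + 1).factorial : ℝ) ≠ 0 := by positivity
  have h6 : (j + 2 : ℝ) ≠ 0 := by positivity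
  simp only [_root_.smul_apply, _root_.neg_apply, innerSL_apply_apply,
    smul_eq_mul, ballKernel, h4, nsmul_eq_mul]
  field_simp
  push_cast
  ring

lemma fderiv_ballKernel_single (j : ℕ) (y : EuclideanSpace ℝ (Fin n)) (i : Fin n) :
    fderiv ℝ (ballKernel (j + 2)) y (EuclideanSpace.single i 1)
      = -2 * y i * ballKernel (j + 1) y := by
  rw [fderiv_ballKernel, EuclideanSpace.inner_single_right]
  simp

lemma differentiable_ballKernel (j : ℕ) : Differentiable ℝ (ballKernel (n := n) (j + 2)) :=
  (contDiff_ballKernel (j + 1)).differentiable (by simp)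

lemma lap_ballKernel (j : ℕ) (y : EuclideanSpace ℝ (Fin n)) :
    lap n (ballKernel (j + 3)) y
      = 4 * ballKernel (j + 1) y - (2 * n + 4 * (j + 2)) * ballKernel (j + 2) y := by
  have h (i : Fin n) : fderiv ℝ (fun y : EuclideanSpace ℝ (Fin n) =>
      fderiv ℝ (ballKernel (j + 3)) y (EuclideanSpace.single i 1)) y (EuclideanSpace.single i 1)
      = -2 * ballKernel (j + 2) y + 4 * (y i) ^ 2 * ballKernel (j + 1) y := by
    simp_rw [fderiv_ballKernel_single (j + 1)]
    have hp : HasFDerivAt (fun y : EuclideanSpace ℝ (Fin n) => -2 * y i)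
        ((-2 : ℝ) • (EuclideanSpace.proj i : EuclideanSpace ℝ (Fin n) →L[ℝ] ℝ)) y :=
      (EuclideanSpace.proj i : EuclideanSpace ℝ (Fin n) →L[ℝ] ℝ).hasFDerivAt.const_mul (-2)
    have hm : HasFDerivAt (fun y : EuclideanSpace ℝ (Fin n) => -2 * y i * ballKernel (j + 2) y)
      _ y := hp.mul (differentiable_ballKernel j y).hasFDerivAt
    rw [hm.fderiv]
    simp only [_root_.add_apply, _root_.smul_apply, smul_eq_mul,
      fderiv_ballKernel_single, PiLp.proj_apply, PiLp.single_apply, if_true]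
    ring
  unfold lap
  simp_rw [h]
  rw [Finset.sum_add_distrib, ← Finset.sum_mul, ← Finset.sum_mul, ← Finset.mul_sum,
    ← EuclideanSpace.real_norm_sq_eq, mul_assoc 4, norm_sq_mul_ballKernel]
  simp
  ring

lemma integrable_ballKernel_mul (j : ℕ) {f : EuclideanSpace ℝ (Fin n) → ℝ} (hf : Continuous f) :
    Integrable (fun y => ballKernel (j + 1) y * f y) :=
  ((continuous_ballKernel _).mul hf).integrable_of_hasCompactSupport
    (hasCompactSupport_ballKernel j).mul_right

lemma integrable_ballKernel (j : ℕ) : Integrable (ballKernel (n := n) (j + 1)) :=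
  (continuous_ballKernel _).integrable_of_hasCompactSupport (hasCompactSupport_ballKernel j)

/-- Integration by parts against the kernels. -/
lemma integral_ballKernel_mul_coord (j : ℕ) (i : Fin n) {g : EuclideanSpace ℝ (Fin n) → ℝ}
    (hg : ContDiff ℝ 1 g) :
    ∫ y, ballKernel (j + 1) y * (y i * g y)
      = 1 / 2 * ∫ y, ballKernel (j + 2) y * fderiv ℝ g y (EuclideanSpace.single i 1) := by
  have hpc : Continuous fun y : EuclideanSpace ℝ (Fin n) => y i :=
    (EuclideanSpace.proj i : EuclideanSpace ℝ (Fin n) →L[ℝ] ℝ).continuous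
  have h1 := integrable_ballKernel_mul j (hpc.mul hg.continuous)
  have h2 : (fun y => fderiv ℝ (ballKernel (j + 2)) y (EuclideanSpace.single i 1) * g y)
      = fun y => -2 * (ballKernel (j + 1) y * (y i * g y)) := by
    ext y; rw [fderiv_ballKernel_single]; ring
  have := integral_mul_fderiv_eq_neg_fderiv_mul_of_integrable (μ := volume)
    (f := ballKernel (n := n) (j + 2)) (g := g) (v := EuclideanSpace.single i 1)
    (by rw [h2]; exact h1.const_mul _)
    (integrable_ballKernel_mul (j + 1)
      ((hg.continuous_fderiv one_ne_zero).clm_apply continuous_const))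
    (integrable_ballKernel_mul (j + 1) hg.continuous)
    (fun y _ => differentiable_ballKernel j y) (fun y _ => hg.differentiable one_ne_zero y)
  rw [this, h2, integral_const_mul]
  ring

/-- The total mass of the kernel `ballKernel j`. -/
def ballMass (n j : ℕ) : ℝ := ∫ y : EuclideanSpace ℝ (Fin n), ballKernel j y

lemma ballMass_pos (j : ℕ) : 0 < ballMass n (j + 1) := by
  refine (continuous_ballKernel (n := n) (j + 1)).integral_pos_of_hasCompactSupport_nonneg_nonzero
    (hasCompactSupport_ballKernel j) (ballKernel_nonneg _) (x := 0) ?_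
  simp [ballKernel, Nat.factorial_ne_zero]

lemma ballKernel_le_indicator (j : ℕ) (y : EuclideanSpace ℝ (Fin n)) :
    ballKernel (j + 1) y
      ≤ (Metric.closedBall (0 : EuclideanSpace ℝ (Fin n)) 1).indicator
        (fun _ => 1 / ((j + 1).factorial : ℝ)) y := by
  by_cases hy : y ∈ Metric.closedBall (0 : EuclideanSpace ℝ (Fin n)) 1
  · rw [indicator_of_mem hy]; exact ballKernel_le _ _
  · rw [indicator_of_notMem hy, ballKernel_eq_zero]
    simp only [Metric.mem_closedBall, dist_zero_right, not_le] at hy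
    exact hy.le

lemma ballMass_le (j : ℕ) :
    ballMass n (j + 1) ≤ volume.real (Metric.closedBall (0 : EuclideanSpace ℝ (Fin n)) 1)
      / (j + 1).factorial := by
  calc ballMass n (j + 1) ≤ ∫ y, (Metric.closedBall (0 : EuclideanSpace ℝ (Fin n)) 1).indicator
        (fun _ => 1 / ((j + 1).factorial : ℝ)) y := by
        refine integral_mono (integrable_ballKernel j) ?_ (ballKernel_le_indicator j)
        exact (integrable_indicator_iff Metric.isClosed_closedBall.measurableSet).2
          (integrableOn_const (isCompact_closedBall _ _).measure_lt_top.ne)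
    _ = _ := by
        rw [integral_indicator_const _ Metric.isClosed_closedBall.measurableSet, smul_eq_mul,
          mul_one_div]

lemma ballMass_succ (j : ℕ) :
    4 * ballMass n (j + 1) = (2 * n + 4 * (j + 2)) * ballMass n (j + 2) := by
  have hpc (i : Fin n) : Continuous fun y : EuclideanSpace ℝ (Fin n) => y i :=
    (EuclideanSpace.proj i : EuclideanSpace ℝ (Fin n) →L[ℝ] ℝ).continuous
  have h (i : Fin n) : ∫ y : EuclideanSpace ℝ (Fin n), ballKernel (j + 1) y * (y i * y i)
      = 1 / 2 * ballMass n (j + 2) := by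
    refine (integral_ballKernel_mul_coord j i
      (EuclideanSpace.proj i : EuclideanSpace ℝ (Fin n) →L[ℝ] ℝ).contDiff).trans ?_
    congr 1
    refine integral_congr_ae (Eventually.of_forall fun y => ?_)
    have : fderiv ℝ (fun y : EuclideanSpace ℝ (Fin n) => y i) y
        = (EuclideanSpace.proj i : EuclideanSpace ℝ (Fin n) →L[ℝ] ℝ) :=
      (EuclideanSpace.proj i : EuclideanSpace ℝ (Fin n) →L[ℝ] ℝ).fderiv
    simp [this]
  have h2 : ∑ i : Fin n, ∫ y : EuclideanSpace ℝ (Fin n), ballKernel (j + 1) y * (y i * y i)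
      = ballMass n (j + 1) - (j + 2) * ballMass n (j + 2) := by
    rw [← integral_finsetSum (f := fun (i : Fin n) (y : EuclideanSpace ℝ (Fin n)) =>
      ballKernel (j + 1) y * (y i * y i)) _
      fun i _ => integrable_ballKernel_mul j ((hpc i).mul (hpc i))]
    rw [ballMass, ballMass, ← integral_const_mul, ← integral_sub (integrable_ballKernel j)
      ((integrable_ballKernel (j + 1)).const_mul _)]
    refine integral_congr_ae (Eventually.of_forall fun y => ?_)
    simp only
    rw [← norm_sq_mul_ballKernel, EuclideanSpace.real_norm_sq_eq, ← Finset.mul_sum, mul_comm]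
    simp_rw [pow_two]
  simp_rw [h] at h2
  simp at h2
  linarith

/-! ### Uniqueness of Laplace transforms -/

open ProbabilityTheory in
/-- Finite measures on `ℝ` with finite and equal moment generating functions on `(-∞, a)`, `a > 0`,
are equal. -/
lemma Measure.ext_of_mgf_eqOn_Iio {μ μ' : Measure ℝ} [IsFiniteMeasure μ] [IsFiniteMeasure μ']
    {a : ℝ} (ha : 0 < a) (h : Iio a ⊆ integrableExpSet id μ) (h' : Iio a ⊆ integrableExpSet id μ')
    (heq : ∀ t < a, mgf id μ t = mgf id μ' t) : μ = μ' := by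
  have hi : Iio a ⊆ interior (integrableExpSet id μ) := interior_maximal h isOpen_Iio
  have hi' : Iio a ⊆ interior (integrableExpSet id μ') := interior_maximal h' isOpen_Iio
  have hX : AnalyticOnNhd ℂ (complexMGF id μ) {z | z.re ∈ Iio a} :=
    analyticOnNhd_complexMGF.mono fun z hz => hi hz
  have hY : AnalyticOnNhd ℂ (complexMGF id μ') {z | z.re ∈ Iio a} :=
    analyticOnNhd_complexMGF.mono fun z hz => hi' hz
  have hfreq : ∃ᶠ z in 𝓝[≠] ((0 : ℝ) : ℂ), complexMGF id μ z = complexMGF id μ' z := by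
    have h_ev : ∀ᶠ x : ℝ in 𝓝[≠] 0, complexMGF id μ x = complexMGF id μ' x := by
      filter_upwards [nhdsWithin_le_nhds (Iio_mem_nhds ha)] with x hx
      rw [complexMGF_ofReal, complexMGF_ofReal, heq x hx]
    have h_tend : Tendsto (fun x : ℝ => (x : ℂ)) (𝓝[≠] 0) (𝓝[≠] ((0 : ℝ) : ℂ)) := by
      refine tendsto_nhdsWithin_iff.2 ⟨?_, ?_⟩
      · exact (Complex.continuous_ofReal.tendsto 0).mono_left nhdsWithin_le_nhds
      · filter_upwards [self_mem_nhdsWithin] with x hx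
        simpa using hx
    exact h_tend.frequently h_ev.frequently
  have hEq := hX.eqOn_of_preconnected_of_frequently_eq hY
    ((convex_Iio a).linear_preimage Complex.reLm).isPreconnected (z₀ := ((0 : ℝ) : ℂ))
    (by simpa using ha) hfreq
  refine Measure.ext_of_charFun (funext fun t => ?_)
  have := hEq (x := Complex.I * t) (by simpa using ha)
  rw [charFun_apply_real, charFun_apply_real]
  simpa [complexMGF, mul_comm, mul_assoc, mul_left_comm] using this

/-- Measures on `ℝ` whose Laplace transforms are finite and agree on `(0, ∞)` are equal. -/
lemma Measure.ext_of_laplace_eq {μ μ' : Measure ℝ}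
    (hfin : ∀ t : ℝ, 0 < t → ∫⁻ s, ENNReal.ofReal (exp (-(t * s))) ∂μ ≠ ⊤)
    (heq : ∀ t : ℝ, 0 < t → ∫⁻ s, ENNReal.ofReal (exp (-(t * s))) ∂μ
      = ∫⁻ s, ENNReal.ofReal (exp (-(t * s))) ∂μ') : μ = μ' := by
  let w : ℝ → ENNReal := fun s => ENNReal.ofReal (exp (-s))
  have hw : Measurable w := by fun_prop
  have key (μ : Measure ℝ) (t : ℝ) : ∫⁻ s, ENNReal.ofReal (exp (t * s)) ∂(μ.withDensity w)
      = ∫⁻ s, ENNReal.ofReal (exp (-((1 - t) * s))) ∂μ := by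
    rw [lintegral_withDensity_eq_lintegral_mul _ hw (by fun_prop)]
    refine lintegral_congr fun s => ?_
    simp only [w, Pi.mul_apply]
    rw [← ENNReal.ofReal_mul (exp_pos _).le, ← Real.exp_add]
    ring_nf
  have hint (μ : Measure ℝ)
      (hfin : ∀ t : ℝ, 0 < t → ∫⁻ s, ENNReal.ofReal (exp (-(t * s))) ∂μ ≠ ⊤) (t : ℝ)
      (ht : t < 1) : Integrable (fun s => exp (t * s)) (μ.withDensity w) := by
    refine ⟨by fun_prop, ?_⟩
    rw [hasFiniteIntegral_iff_ofReal (Eventually.of_forall fun s => (exp_pos _).le), key]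
    exact (hfin _ (by linarith)).lt_top
  have hfin' : ∀ t : ℝ, 0 < t → ∫⁻ s, ENNReal.ofReal (exp (-(t * s))) ∂μ' ≠ ⊤ :=
    fun t ht => heq t ht ▸ hfin t ht
  have hfinite (μ : Measure ℝ)
      (hfin : ∀ t : ℝ, 0 < t → ∫⁻ s, ENNReal.ofReal (exp (-(t * s))) ∂μ ≠ ⊤) :
      IsFiniteMeasure (μ.withDensity w) := by
    refine isFiniteMeasure_withDensity ?_
    simpa [w] using hfin 1 one_pos
  have := hfinite μ hfin
  have := hfinite μ' hfin'
  have hE : μ.withDensity w = μ'.withDensity w := by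
    refine Measure.ext_of_mgf_eqOn_Iio one_pos (fun t ht => hint μ hfin t ht)
      (fun t ht => hint μ' hfin' t ht) fun t ht => ?_
    simp only [ProbabilityTheory.mgf, id]
    rw [integral_eq_lintegral_of_nonneg_ae (Eventually.of_forall fun s => (exp_pos _).le)
      (by fun_prop), integral_eq_lintegral_of_nonneg_ae
      (Eventually.of_forall fun s => (exp_pos _).le) (by fun_prop), key, key,
      heq _ (by linarith)]
  have hinv (μ : Measure ℝ) : (μ.withDensity w).withDensity w⁻¹ = μ :=
    withDensity_inv_same hw (Eventually.of_forall fun s => by simp [w, exp_pos])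
      (Eventually.of_forall fun s => by simp [w])
  rw [← hinv μ, hE, hinv]

/-! ### Kernel averages of smooth functions -/

lemma hasDerivAt_integral_ballKernel (j : ℕ) {v : EuclideanSpace ℝ (Fin n) → ℝ}
    (hv : ContDiff ℝ 2 v) (x : EuclideanSpace ℝ (Fin n)) (r : ℝ) :
    HasDerivAt (fun r => ∫ y, ballKernel (j + 1) y * v (x + r • y))
      (r / 2 * ∫ y, ballKernel (j + 2) y * lap n v (x + r • y)) r := by
  have hv1 : ContDiff ℝ 1 v := hv.of_le (by norm_num)
  have hdv : ContDiff ℝ 1 (fderiv ℝ v) := hv.fderiv_right (by norm_num)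
  have hder (r : ℝ) (y : EuclideanSpace ℝ (Fin n)) : HasDerivAt
      (fun r : ℝ => ballKernel (j + 1) y * v (x + r • y))
      (ballKernel (j + 1) y * fderiv ℝ v (x + r • y) y) r := by
    have h1 : HasDerivAt (fun r : ℝ => x + r • y) y r := by
      simpa using ((hasDerivAt_id r).smul_const y).const_add x
    exact (((hv1.differentiable one_ne_zero _).hasFDerivAt).comp_hasDerivAt r h1).const_mul _
  have hcont : Continuous fun p : ℝ × EuclideanSpace ℝ (Fin n) =>
      fderiv ℝ v (x + p.1 • p.2) p.2 :=
    (hdv.continuous.comp (by fun_prop)).clm_apply continuous_snd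
  obtain ⟨C, hC⟩ := ((isCompact_closedBall r 1).prod
    (isCompact_closedBall (0 : EuclideanSpace ℝ (Fin n)) 1)).exists_bound_of_continuousOn
    hcont.continuousOn
  have hmain := (hasDerivAt_integral_of_dominated_loc_of_deriv_le (μ := volume)
    (F := fun (r : ℝ) y => ballKernel (j + 1) y * v (x + r • y))
    (F' := fun (r : ℝ) y => ballKernel (j + 1) y * fderiv ℝ v (x + r • y) y)
    (x₀ := r) (s := Metric.closedBall r 1)
    (bound := fun y => ballKernel (j + 1) y * C)
    (Metric.closedBall_mem_nhds r one_pos)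
    (Eventually.of_forall fun r => (integrable_ballKernel_mul j
      (hv.continuous.comp (by fun_prop))).aestronglyMeasurable)
    (integrable_ballKernel_mul j (hv.continuous.comp (by fun_prop)))
    (integrable_ballKernel_mul j (hcont.comp (by fun_prop :
      Continuous fun y : EuclideanSpace ℝ (Fin n) => (r, y)))).aestronglyMeasurable
    (Eventually.of_forall fun y ρ hρ => ?_)
    ((integrable_ballKernel j).mul_const C)
    (Eventually.of_forall fun y ρ _ => hder ρ y)).2
  · refine hmain.congr_deriv ?_
    have hcomp (i : Fin n) : ContDiff ℝ 1 fun y : EuclideanSpace ℝ (Fin n) =>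
        fderiv ℝ v (x + r • y) (EuclideanSpace.single i 1) :=
      (hdv.comp (by fun_prop)).clm_apply contDiff_const
    have hpc (i : Fin n) : Continuous fun y : EuclideanSpace ℝ (Fin n) => y i :=
      (EuclideanSpace.proj i : EuclideanSpace ℝ (Fin n) →L[ℝ] ℝ).continuous
    have hexp (y : EuclideanSpace ℝ (Fin n)) : ballKernel (j + 1) y * fderiv ℝ v (x + r • y) y
        = ∑ i, ballKernel (j + 1) y
          * (y i * fderiv ℝ v (x + r • y) (EuclideanSpace.single i 1)) := by
      rw [← Finset.mul_sum]
      congr 1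
      have hy : y = ∑ i, y i • EuclideanSpace.single i (1 : ℝ) := by
        simpa using ((EuclideanSpace.basisFun (Fin n) ℝ).sum_repr y).symm
      have hL (L : EuclideanSpace ℝ (Fin n) →L[ℝ] ℝ) :
          L y = ∑ i, y i * L (EuclideanSpace.single i 1) := by
        conv_lhs => rw [hy, map_sum]
        simp
      exact hL _
    have hscale (i : Fin n) (y : EuclideanSpace ℝ (Fin n)) :
        fderiv ℝ (fun y : EuclideanSpace ℝ (Fin n) =>
          fderiv ℝ v (x + r • y) (EuclideanSpace.single i 1)) y (EuclideanSpace.single i 1)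
        = r * fderiv ℝ (fun z => fderiv ℝ v z (EuclideanSpace.single i 1)) (x + r • y)
          (EuclideanSpace.single i 1) := by
      have hA : HasFDerivAt (fun y : EuclideanSpace ℝ (Fin n) => x + r • y)
          (r • ContinuousLinearMap.id ℝ (EuclideanSpace ℝ (Fin n))) y :=
        ((hasFDerivAt_id y).const_smul r).const_add x
      have hB : DifferentiableAt ℝ (fun z => fderiv ℝ v z (EuclideanSpace.single i 1))
          (x + r • y) := ((hdv.clm_apply contDiff_const).differentiable one_ne_zero) _
      have hAB : HasFDerivAt (fun y : EuclideanSpace ℝ (Fin n) =>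
          fderiv ℝ v (x + r • y) (EuclideanSpace.single i 1)) _ y :=
        HasFDerivAt.comp (g := fun z => fderiv ℝ v z (EuclideanSpace.single i 1)) y
          hB.hasFDerivAt hA
      rw [hAB.fderiv]
      simp
    have hdd (i : Fin n) : Continuous fun y : EuclideanSpace ℝ (Fin n) =>
        fderiv ℝ (fun z => fderiv ℝ v z (EuclideanSpace.single i 1)) (x + r • y)
          (EuclideanSpace.single i 1) := by
      have : ContDiff ℝ 1 (fun z => fderiv ℝ v z (EuclideanSpace.single i 1)) :=
        hdv.clm_apply contDiff_const
      exact ((this.continuous_fderiv one_ne_zero).comp (by fun_prop)).clm_apply continuous_const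
    simp_rw [hexp]
    rw [integral_finsetSum (f := fun i y => ballKernel (j + 1) y
      * (y i * fderiv ℝ v (x + r • y) (EuclideanSpace.single i 1))) _
      fun i _ => integrable_ballKernel_mul j ((hpc i).mul (hcomp i).continuous)]
    simp_rw [integral_ballKernel_mul_coord j _ (hcomp _), hscale, lap, Finset.mul_sum]
    rw [integral_finsetSum _ fun i _ => integrable_ballKernel_mul (j + 1) (hdd i), Finset.mul_sum]
    refine Finset.sum_congr rfl fun i _ => ?_
    rw [← integral_const_mul, ← integral_const_mul]
    refine integral_congr_ae (Eventually.of_forall fun y => ?_)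
    simp only
    ring
  · rw [norm_mul, Real.norm_of_nonneg (ballKernel_nonneg _ _)]
    by_cases hy : ‖y‖ ≤ 1
    · exact mul_le_mul_of_nonneg_left (hC (ρ, y) ⟨hρ, by simpa using hy⟩) (ballKernel_nonneg _ _)
    · rw [ballKernel_eq_zero j (not_le.1 hy).le]; simp

/-- Expansion of a kernel average in powers of the Laplacian (Pizzetti's formula) for a sequence
of functions each of which is the Laplacian of the previous one. -/
lemma hasSum_ballKernel_expansion (m : ℕ) {v : ℕ → EuclideanSpace ℝ (Fin n) → ℝ}
    (hv : ∀ k, ContDiff ℝ 2 (v k)) (hlap : ∀ k y, lap n (v k) y = v (k + 1) y)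
    (x : EuclideanSpace ℝ (Fin n)) (hnn : ∀ k, 0 ≤ v k x) {C τ : ℝ} (hτ : 0 < τ)
    (hC : ∀ k y, ‖y‖ ≤ 1 → |v k (x + y)| ≤ C * (k.factorial / τ ^ k)) :
    HasSum (fun k => ballMass n (m + 1 + k) / (4 ^ k * k.factorial) * v k x)
      (∫ y, ballKernel (m + 1) y * v 0 (x + y)) := by
  set V := volume.real (Metric.closedBall (0 : EuclideanSpace ℝ (Fin n)) 1)
  have hC0 : 0 ≤ C := by
    have := (abs_nonneg _).trans (hC 0 0 (by simp))
    simpa using this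
  let E : ℕ → ℝ → ℝ := fun k r => ∫ y, ballKernel (m + 1 + k) y * v k (x + r • y)
  have hE (k : ℕ) (r : ℝ) : HasDerivAt (E k) (r / 2 * E (k + 1) r) r := by
    have := hasDerivAt_integral_ballKernel (m + k) (hv k) x r
    simp only [hlap] at this
    rwa [show m + k + 1 = m + 1 + k by omega, show m + k + 2 = m + 1 + (k + 1) by omega] at this
  have hEle (k : ℕ) (r : ℝ) (hr : r ∈ Icc (0 : ℝ) 1) : |E k r| ≤ V * C / τ ^ k := by
    have h1 : |E k r| ≤ ∫ y : EuclideanSpace ℝ (Fin n),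
        ballKernel (m + 1 + k) y * (C * (k.factorial / τ ^ k)) := by
      rw [← Real.norm_eq_abs]
      refine norm_integral_le_of_norm_le ?_ (Eventually.of_forall fun y => ?_)
      · rw [add_right_comm]
        exact (integrable_ballKernel (m + k)).mul_const _
      · rw [norm_mul, Real.norm_of_nonneg (ballKernel_nonneg _ _)]
        by_cases hy : ‖y‖ ≤ 1
        · refine mul_le_mul_of_nonneg_left (hC k _ ?_) (ballKernel_nonneg _ _)
          rw [norm_smul, Real.norm_of_nonneg hr.1]
          exact mul_le_one₀ hr.2 (norm_nonneg _) hy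
        · rw [add_right_comm, ballKernel_eq_zero _ (not_le.1 hy).le]; simp
    rw [integral_mul_const] at h1
    have h2 : ballMass n (m + 1 + k) ≤ V / k.factorial := by
      rw [add_right_comm]
      refine (ballMass_le (n := n) (m + k)).trans ?_
      have : (k.factorial : ℝ) ≤ (m + k + 1).factorial := by
        exact_mod_cast Nat.factorial_le (by omega)
      gcongr
    calc |E k r| ≤ ballMass n (m + 1 + k) * (C * (k.factorial / τ ^ k)) := h1
      _ ≤ V / k.factorial * (C * (k.factorial / τ ^ k)) := by gcongr
      _ = V * C / τ ^ k := by
        have : (k.factorial : ℝ) ≠ 0 := by positivity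
        field_simp
  let P : ℕ → ℝ → ℝ := fun K r =>
    ∑ k ∈ Finset.range K, E k r * ((1 - r ^ 2) ^ k / (4 ^ k * k.factorial))
  have hP (K : ℕ) (r : ℝ) : HasDerivAt (P (K + 1))
      (r / 2 * E (K + 1) r * ((1 - r ^ 2) ^ K / (4 ^ K * K.factorial))) r := by
    induction K with
    | zero => simpa [P] using hE 0 r
    | succ K ih =>
      have h1 : HasDerivAt (fun r : ℝ => (1 - r ^ 2) ^ (K + 1) / (4 ^ (K + 1) * (K + 1).factorial))
          ((K + 1 : ℕ) * (1 - r ^ 2) ^ K * (-(2 * r)) / (4 ^ (K + 1) * (K + 1).factorial)) r := by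
        have h2 : HasDerivAt (fun r : ℝ => 1 - r ^ 2) (-(2 * r)) r := by
          simpa using (hasDerivAt_pow 2 r).const_sub 1
        simpa using (h2.pow (K + 1)).div_const (4 ^ (K + 1) * ((K + 1).factorial : ℝ))
      have h3 := ih.add ((hE (K + 1) r).mul h1)
      have h4 : P (K + 1 + 1) = P (K + 1) + E (K + 1) *
          fun r : ℝ => (1 - r ^ 2) ^ (K + 1) / (4 ^ (K + 1) * (K + 1).factorial) := by
        ext r
        simp [P, Finset.sum_range_succ]
      rw [h4]
      refine h3.congr_deriv ?_
      have h5 : (K.factorial : ℝ) ≠ 0 := by positivity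
      have h6 : (K + 1 : ℝ) ≠ 0 := by positivity
      rw [Nat.factorial_succ]
      push_cast
      field_simp
      ring
  have hP0 (K : ℕ) : P K 0
      = ∑ k ∈ Finset.range K, ballMass n (m + 1 + k) / (4 ^ k * k.factorial) * v k x := by
    refine Finset.sum_congr rfl fun k _ => ?_
    simp only [E, zero_smul, add_zero, ballMass]
    rw [integral_mul_const]
    simp
    ring
  have hP1 (K : ℕ) : P (K + 1) 1 = ∫ y, ballKernel (m + 1) y * v 0 (x + y) := by
    simp [P, Finset.sum_range_succ', E]
  rw [hasSum_iff_tendsto_nat_of_nonneg, ← tendsto_add_atTop_iff_nat 1]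
  · simp_rw [← hP0]
    rw [tendsto_iff_norm_sub_tendsto_zero]
    have hlim : Tendsto (fun K : ℕ => V * C / τ * ((1 / (4 * τ)) ^ K / K.factorial)) atTop
        (𝓝 0) := by
      simpa using (FloorSemiring.tendsto_pow_div_factorial_atTop (1 / (4 * τ))).const_mul
        (V * C / τ)
    refine squeeze_zero (fun _ => norm_nonneg _) (fun K => ?_) hlim
    rw [← hP1 K, norm_sub_rev]
    refine norm_image_sub_le_of_norm_deriv_le_segment_01'
      (fun r _ => (hP K r).hasDerivWithinAt) fun r hr => ?_
    have hr' : r ∈ Icc (0 : ℝ) 1 := ⟨hr.1, hr.2.le⟩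
    have h1 : 0 ≤ 1 - r ^ 2 := by nlinarith [hr.1, hr.2]
    have h2 : (1 - r ^ 2) ^ K ≤ 1 := pow_le_one₀ h1 (by nlinarith [hr.1])
    rw [norm_mul, norm_mul, Real.norm_of_nonneg (div_nonneg hr.1 zero_le_two),
      Real.norm_of_nonneg (div_nonneg (pow_nonneg h1 K) (by positivity)), Real.norm_eq_abs]
    calc r / 2 * |E (K + 1) r| * ((1 - r ^ 2) ^ K / (4 ^ K * K.factorial))
        ≤ 1 * (V * C / τ ^ (K + 1)) * (1 / (4 ^ K * K.factorial)) := by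
          have := hEle (K + 1) r hr'
          have hV : 0 ≤ V := measureReal_nonneg
          gcongr
          linarith [hr.2]
      _ = V * C / τ * ((1 / (4 * τ)) ^ K / K.factorial) := by
          have : (K.factorial : ℝ) ≠ 0 := by positivity
          rw [pow_succ, div_pow, mul_pow, one_pow]
          field_simp
  · intro k
    rw [add_right_comm]
    exact mul_nonneg (div_nonneg (ballMass_pos _).le (by positivity)) (hnn k)

/-! ### Time derivatives of ancient solutions -/

/-- The derivative of a function on spacetime in the time direction. -/
def timeDeriv (u : EuclideanSpace ℝ (Fin n) × ℝ → ℝ) (p : EuclideanSpace ℝ (Fin n) × ℝ) : ℝ :=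
  fderiv ℝ u p (0, 1)

lemma contDiff_fderiv_apply {F : Type*} [NormedAddCommGroup F] [NormedSpace ℝ F] {f : F → ℝ}
    (hf : ContDiff ℝ (⊤ : ℕ∞) f) (w : F) : ContDiff ℝ (⊤ : ℕ∞) fun p => fderiv ℝ f p w :=
  (hf.fderiv_right (by simp)).clm_apply contDiff_const

lemma fderiv_fderiv_apply_comm {F : Type*} [NormedAddCommGroup F] [NormedSpace ℝ F] {f : F → ℝ}
    (hf : ContDiff ℝ (⊤ : ℕ∞) f) (v w p : F) :
    fderiv ℝ (fun q => fderiv ℝ f q v) p w = fderiv ℝ (fun q => fderiv ℝ f q w) p v := by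
  have hf2 : ContDiff ℝ 2 f := mod_cast contDiff_infty.1 hf 2
  have hd : DifferentiableAt ℝ (fderiv ℝ f) p :=
    (hf2.fderiv_right (m := 1) (by norm_num)).differentiable one_ne_zero p
  have h := hf2.contDiffAt (x := p) |>.isSymmSndFDerivAt (by simp)
  have key (v w : F) : fderiv ℝ (fun q => fderiv ℝ f q v) p w = fderiv ℝ (fderiv ℝ f) p w v := by
    have := (hd.hasFDerivAt.clm_apply (hasFDerivAt_const v p)).fderiv
    rw [this]
    simp
  rw [key, key]
  exact h w v

lemma lap_slice {u : EuclideanSpace ℝ (Fin n) × ℝ → ℝ} (hu : ContDiff ℝ (⊤ : ℕ∞) u)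
    (x : EuclideanSpace ℝ (Fin n)) (t : ℝ) :
    lap n (fun y => u (y, t)) x = ∑ i : Fin n,
      fderiv ℝ (fun p => fderiv ℝ u p (EuclideanSpace.single i 1, 0)) (x, t)
        (EuclideanSpace.single i 1, 0) := by
  have key {f : EuclideanSpace ℝ (Fin n) × ℝ → ℝ} (hf : ContDiff ℝ (⊤ : ℕ∞) f)
      (y v : EuclideanSpace ℝ (Fin n)) :
      fderiv ℝ (fun y => f (y, t)) y v = fderiv ℝ f (y, t) (v, 0) := by
    have h := ((hf.differentiable (by simp) (y, t)).hasFDerivAt).comp y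
      (hasFDerivAt_prodMk_left (𝕜 := ℝ) y t)
    have h' : HasFDerivAt (fun y => f (y, t)) _ y := h
    rw [h'.fderiv]
    simp
  unfold lap
  refine Finset.sum_congr rfl fun i _ => ?_
  simp_rw [key hu]
  exact key (contDiff_fderiv_apply hu _) _ _

lemma contDiff_timeDeriv {u : EuclideanSpace ℝ (Fin n) × ℝ → ℝ} (hu : ContDiff ℝ (⊤ : ℕ∞) u) :
    ContDiff ℝ (⊤ : ℕ∞) (timeDeriv u) :=
  contDiff_fderiv_apply hu _

lemma hasDerivAt_timeDeriv {u : EuclideanSpace ℝ (Fin n) × ℝ → ℝ} (hu : ContDiff ℝ (⊤ : ℕ∞) u)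
    (x : EuclideanSpace ℝ (Fin n)) (t : ℝ) :
    HasDerivAt (fun s => u (x, s)) (timeDeriv u (x, t)) t := by
  have h := ((hu.differentiable (by simp) (x, t)).hasFDerivAt).comp_hasDerivAt t
    ((hasDerivAt_const t x).prodMk (hasDerivAt_id t))
  exact h

lemma lap_timeDeriv {u : EuclideanSpace ℝ (Fin n) × ℝ → ℝ} (hu : ContDiff ℝ (⊤ : ℕ∞) u)
    (hheat : ∀ x, ∀ t < 0, lap n (fun y => u (y, t)) x = timeDeriv u (x, t))
    (x : EuclideanSpace ℝ (Fin n)) {t : ℝ} (ht : t < 0) :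
    lap n (fun y => timeDeriv u (y, t)) x = timeDeriv (timeDeriv u) (x, t) := by
  let D : Fin n → (EuclideanSpace ℝ (Fin n) × ℝ → ℝ) → EuclideanSpace ℝ (Fin n) × ℝ → ℝ :=
    fun i f p => fderiv ℝ f p (EuclideanSpace.single i 1, 0)
  have hD (i : Fin n) {f : EuclideanSpace ℝ (Fin n) × ℝ → ℝ} (hf : ContDiff ℝ (⊤ : ℕ∞) f) :
      ContDiff ℝ (⊤ : ℕ∞) (D i f) := contDiff_fderiv_apply hf _
  have hcomm (i : Fin n) {f : EuclideanSpace ℝ (Fin n) × ℝ → ℝ} (hf : ContDiff ℝ (⊤ : ℕ∞) f) :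
      timeDeriv (D i f) = D i (timeDeriv f) :=
    funext fun p => fderiv_fderiv_apply_comm hf _ _ p
  have h1 : timeDeriv u =ᶠ[𝓝 (x, t)] fun p => ∑ i, D i (D i u) p := by
    have hopen : ∀ᶠ p : EuclideanSpace ℝ (Fin n) × ℝ in 𝓝 (x, t), p.2 < 0 :=
      continuous_snd.continuousAt.eventually (Iio_mem_nhds ht)
    filter_upwards [hopen] with p hp
    rw [← hheat p.1 p.2 hp, lap_slice hu]
  rw [lap_slice (contDiff_timeDeriv hu)]
  have h2 : timeDeriv (timeDeriv u) (x, t) = ∑ i, timeDeriv (D i (D i u)) (x, t) := by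
    simp only [timeDeriv.eq_1 (timeDeriv u), timeDeriv.eq_1 (D _ _)]
    rw [h1.fderiv_eq,
      fderiv_fun_sum fun i _ => (hD i (hD i hu)).differentiable (by simp) _]
    simp
  rw [h2]
  refine Finset.sum_congr rfl fun i _ => ?_
  rw [hcomm i (hD i hu), hcomm i hu]

lemma iterate_timeDeriv {u : EuclideanSpace ℝ (Fin n) × ℝ → ℝ} (hu : IsAncientHeat n u) (k : ℕ) :
    ContDiff ℝ (⊤ : ℕ∞) (timeDeriv^[k] u) ∧ ∀ x, ∀ t < 0,
      lap n (fun y => timeDeriv^[k] u (y, t)) x = timeDeriv^[k + 1] u (x, t) := by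
  induction k with
  | zero =>
    refine ⟨hu.1, fun x t ht => ?_⟩
    simp only [Function.iterate_zero, id, zero_add, Function.iterate_one]
    rw [hu.2 x t ht.le, (hasDerivAt_timeDeriv hu.1 x t).deriv]
  | succ k ih =>
    simp only [Function.iterate_succ_apply'] at ih ⊢
    exact ⟨contDiff_timeDeriv ih.1, fun x t ht => lap_timeDeriv ih.1 ih.2 x ht⟩

/-! ### The symbol of a kernel -/

/-- The entire function `s ↦ ∑ₖ ballMass n (j + k) sᵏ / (4ᵏ k!)`: averaging an eigenfunction of the
Laplacian with eigenvalue `s` against `ballKernel j` multiplies it by `ballSymbol n j s`. -/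
def ballSymbol (n j : ℕ) (s : ℝ) : ℝ :=
  ∑' k, ballMass n (j + k) / (4 ^ k * k.factorial) * s ^ k

lemma summable_ballSymbol (j : ℕ) (s : ℝ) :
    Summable fun k => ballMass n (j + 1 + k) / (4 ^ k * k.factorial) * s ^ k := by
  set V := volume.real (Metric.closedBall (0 : EuclideanSpace ℝ (Fin n)) 1)
  refine Summable.of_norm_bounded ((Real.summable_pow_div_factorial |s|).mul_left V) fun k => ?_
  have h1 : ballMass n (j + 1 + k) ≤ V := by
    rw [add_right_comm]
    refine (ballMass_le _).trans (div_le_self measureReal_nonneg ?_)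
    exact_mod_cast Nat.one_le_iff_ne_zero.2 (Nat.factorial_ne_zero _)
  have h0 : 0 ≤ ballMass n (j + 1 + k) := by rw [add_right_comm]; exact (ballMass_pos _).le
  have h4 : (1 : ℝ) ≤ 4 ^ k := one_le_pow₀ (by norm_num)
  have hk : (0 : ℝ) < k.factorial := by positivity
  rw [norm_mul, norm_pow, Real.norm_eq_abs s, Real.norm_of_nonneg (by positivity)]
  calc ballMass n (j + 1 + k) / (4 ^ k * k.factorial) * |s| ^ k
      ≤ V / (1 * k.factorial) * |s| ^ k := by gcongr
    _ = V * (|s| ^ k / k.factorial) := by ring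

lemma measurable_ballSymbol (j : ℕ) : Measurable (ballSymbol n (j + 1)) :=
  measurable_of_tendsto_metrizable
    (f := fun K s => ∑ k ∈ Finset.range K,
      ballMass n (j + 1 + k) / (4 ^ k * k.factorial) * s ^ k)
    (fun K => by fun_prop)
    (tendsto_pi_nhds.2 fun s => (summable_ballSymbol j s).hasSum.tendsto_sum_nat)

lemma ballMass_le_ballSymbol (j : ℕ) {s : ℝ} (hs : 0 ≤ s) :
    ballMass n (j + 1) ≤ ballSymbol n (j + 1) s := by
  have := (summable_ballSymbol (n := n) j s).le_tsum 0 fun k _ => by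
    have : 0 < ballMass n (j + 1 + k) := by rw [add_right_comm]; exact ballMass_pos _
    positivity
  simpa [ballSymbol] using this

lemma ballSymbol_pos (j : ℕ) {s : ℝ} (hs : 0 ≤ s) : 0 < ballSymbol n (j + 1) s :=
  (ballMass_pos j).trans_le (ballMass_le_ballSymbol j hs)

lemma ballSymbol_succ (j : ℕ) (s : ℝ) :
    4 * ballSymbol n (j + 1) s - (2 * n + 4 * (j + 2)) * ballSymbol n (j + 2) s
      = s * ballSymbol n (j + 3) s := by
  have h1 := ((summable_ballSymbol (n := n) j s).hasSum.mul_left 4).sub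
    ((summable_ballSymbol (n := n) (j + 1) s).hasSum.mul_left (2 * n + 4 * (j + 2) : ℝ))
  have h2 := (summable_ballSymbol (n := n) (j + 2) s).hasSum.mul_left s
  refine h1.unique ((hasSum_nat_add_iff' 1).1 ?_)
  have h3 := ballMass_succ (n := n) j
  simp only [Finset.range_one, Finset.sum_singleton, pow_zero, Nat.factorial_zero, Nat.cast_one,
    mul_one, div_one, add_zero]
  rw [h3, sub_self, sub_zero]
  refine h2.congr_fun fun k => ?_
  have h4 := ballMass_succ (n := n) (j + (k + 1))
  rw [show j + 1 + (k + 1) = j + (k + 1) + 1 by omega,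
    show j + 1 + 1 + (k + 1) = j + (k + 1) + 2 by omega,
    show j + 2 + 1 + k = j + (k + 1) + 2 by omega]
  have h5 : (k.factorial : ℝ) ≠ 0 := by positivity
  have h6 : (k + 1 : ℝ) ≠ 0 := by positivity
  rw [Nat.factorial_succ]
  push_cast at h4 ⊢
  field_simp
  linear_combination 4 ^ k * s ^ (k + 1) * h4

/-! ### Moments of measures on the half-line -/

section Moments

variable {μ : Measure ℝ}

lemma ae_nonneg_of_Iio_eq_zero (h0 : μ (Iio 0) = 0) : ∀ᵐ s ∂μ, 0 ≤ s := by
  rw [ae_iff]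
  simpa [Iio] using h0

lemma pow_mul_exp_neg_le {s τ : ℝ} (hs : 0 ≤ s) (hτ : 0 < τ) (k : ℕ) :
    s ^ k * exp (-(τ * s)) ≤ k.factorial / τ ^ k := by
  have h := Real.pow_div_factorial_le_exp (τ * s) (by positivity) k
  rw [div_le_iff₀ (by positivity), mul_pow] at h
  rw [Real.exp_neg, ← div_eq_mul_inv, div_le_div_iff₀ (exp_pos _) (by positivity)]
  linarith

lemma integral_pow_mul_exp_neg_nonneg (h0 : μ (Iio 0) = 0) (τ : ℝ) (k : ℕ) :
    0 ≤ ∫ s, s ^ k * exp (-(τ * s)) ∂μ := by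
  refine integral_nonneg_of_ae ?_
  filter_upwards [ae_nonneg_of_Iio_eq_zero h0] with s hs
  simp only [Pi.zero_apply]
  positivity

variable [IsFiniteMeasure μ]

lemma integrable_pow_mul_exp_neg (h0 : μ (Iio 0) = 0) {τ : ℝ} (hτ : 0 < τ) (k : ℕ) :
    Integrable (fun s => s ^ k * exp (-(τ * s))) μ := by
  refine Integrable.of_bound (by fun_prop) (k.factorial / τ ^ k) ?_
  filter_upwards [ae_nonneg_of_Iio_eq_zero h0] with s hs
  rw [Real.norm_of_nonneg (by positivity)]
  exact pow_mul_exp_neg_le hs hτ k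

lemma integral_pow_mul_exp_neg_le (h0 : μ (Iio 0) = 0) {τ : ℝ} (hτ : 0 < τ) (k : ℕ) :
    ∫ s, s ^ k * exp (-(τ * s)) ∂μ ≤ μ.real univ * (k.factorial / τ ^ k) := by
  calc ∫ s, s ^ k * exp (-(τ * s)) ∂μ ≤ ∫ _, k.factorial / τ ^ k ∂μ := by
        refine integral_mono_ae (integrable_pow_mul_exp_neg h0 hτ k) (integrable_const _) ?_
        filter_upwards [ae_nonneg_of_Iio_eq_zero h0] with s hs using pow_mul_exp_neg_le hs hτ k
    _ = _ := by simp

lemma hasDerivAt_integral_pow_mul_exp (h0 : μ (Iio 0) = 0) {t : ℝ} (ht : t < 0) (k : ℕ) :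
    HasDerivAt (fun t => ∫ s, s ^ k * exp (t * s) ∂μ) (∫ s, s ^ (k + 1) * exp (t * s) ∂μ) t := by
  have hsub : Iio 0 ⊆ ProbabilityTheory.integrableExpSet id μ := fun r hr => by
    have := integrable_pow_mul_exp_neg h0 (τ := -r) (by simpa using hr) 0
    simpa [ProbabilityTheory.integrableExpSet] using this
  exact ProbabilityTheory.hasDerivAt_integral_pow_mul_exp_real (X := id)
    (interior_maximal hsub isOpen_Iio ht) k

lemma tendsto_integral_exp_neg (h0 : μ (Iio 0) = 0) :
    Tendsto (fun τ : ℝ => ∫ s, exp (-(τ * s)) ∂μ) (𝓝[>] 0) (𝓝 (μ.real univ)) := by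
  have h1 : μ.real univ = ∫ _, (1 : ℝ) ∂μ := by simp
  rw [h1]
  refine tendsto_integral_filter_of_dominated_convergence (fun _ => 1)
    (Eventually.of_forall fun τ => by fun_prop) ?_ (integrable_const 1) ?_
  · filter_upwards [self_mem_nhdsWithin] with τ hτ
    filter_upwards [ae_nonneg_of_Iio_eq_zero h0] with s hs
    rw [Real.norm_of_nonneg (exp_pos _).le]
    exact Real.exp_le_one_iff.2 (neg_nonpos.2 (mul_nonneg (le_of_lt hτ) hs))
  · refine Eventually.of_forall fun s => ?_
    have : Continuous fun τ : ℝ => exp (-(τ * s)) := by fun_prop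
    simpa using (this.tendsto 0).mono_left nhdsWithin_le_nhds

lemma setIntegral_id_eq (t : ℝ) :
    ∫ s in Icc 0 t, s ∂μ = t * μ.real (Icc 0 t) - ∫ σ in Icc 0 t, μ.real (Icc 0 σ) := by
  have hmeas : MeasurableSet {p : ℝ × ℝ | p.2 ≤ p.1} := measurableSet_le measurable_snd measurable_fst
  have hswap := integral_integral_swap (μ := volume.restrict (Icc 0 t)) (ν := μ.restrict (Icc 0 t))
    (f := fun σ s => {p : ℝ × ℝ | p.2 ≤ p.1}.indicator (fun _ => (1 : ℝ)) (σ, s))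
    ((integrable_const (1 : ℝ)).indicator hmeas)
  have hL : ∫ σ in Icc 0 t, ∫ s in Icc 0 t,
      {p : ℝ × ℝ | p.2 ≤ p.1}.indicator (fun _ => (1 : ℝ)) (σ, s) ∂μ
      = ∫ σ in Icc 0 t, μ.real (Icc 0 σ) := by
    refine setIntegral_congr_fun measurableSet_Icc fun σ hσ => ?_
    have h1 : (fun s => {p : ℝ × ℝ | p.2 ≤ p.1}.indicator (fun _ => (1 : ℝ)) (σ, s))
        = (Iic σ).indicator fun _ => 1 := by
      ext s; simp [indicator_apply]
    simp only [h1]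
    rw [integral_indicator_const _ measurableSet_Iic, measureReal_restrict_apply measurableSet_Iic,
      smul_eq_mul, mul_one]
    congr 1
    ext s
    simp only [mem_inter_iff, mem_Iic, mem_Icc]
    exact ⟨fun h => ⟨h.2.1, h.1⟩, fun h => ⟨h.2, h.1, h.2.trans hσ.2⟩⟩
  have hR : ∫ s in Icc 0 t, ∫ σ in Icc 0 t,
      {p : ℝ × ℝ | p.2 ≤ p.1}.indicator (fun _ => (1 : ℝ)) (σ, s) ∂volume ∂μ
      = ∫ s in Icc 0 t, (t - s) ∂μ := by
    refine setIntegral_congr_fun measurableSet_Icc fun s hs => ?_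
    have h1 : (fun σ => {p : ℝ × ℝ | p.2 ≤ p.1}.indicator (fun _ => (1 : ℝ)) (σ, s))
        = (Ici s).indicator fun _ => 1 := by
      ext s; simp [indicator_apply]
    simp only [h1]
    rw [integral_indicator_const _ measurableSet_Ici, measureReal_restrict_apply measurableSet_Ici,
      smul_eq_mul, mul_one]
    have : Ici s ∩ Icc 0 t = Icc s t := by
      ext σ
      simp only [mem_inter_iff, mem_Ici, mem_Icc]
      exact ⟨fun h => ⟨h.1, h.2.2⟩, fun h => ⟨h.1, hs.1.trans h.1, h.2⟩⟩
    rw [this, Real.volume_real_Icc_of_le hs.2]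
  have hid : IntegrableOn (fun s : ℝ => s) (Icc 0 t) μ := continuous_id.integrableOn_Icc
  rw [hL, hR, integral_sub (integrable_const t) hid] at hswap
  rw [hswap]
  simp
  ring

end Moments

/-! ### Families of measures representing an ancient solution -/

/-- The measures `ν x` on `[0, ∞)` have Laplace transforms `t ↦ u (x, -t)`, where `u` is an ancient
solution of the heat equation, and depend measurably on `x`. -/
structure IsLaplaceFamily (u : EuclideanSpace ℝ (Fin n) × ℝ → ℝ)
    (ν : EuclideanSpace ℝ (Fin n) → Measure ℝ) : Prop where
  heat : IsAncientHeat n u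
  isFiniteMeasure : ∀ x, IsFiniteMeasure (ν x)
  Iio_zero : ∀ x, ν x (Iio 0) = 0
  eq_integral : ∀ x t, 0 < t → u (x, -t) = ∫ s, exp (-(t * s)) ∂ν x
  measurable_Icc : Measurable fun p : EuclideanSpace ℝ (Fin n) × ℝ => (ν p.1 (Icc 0 p.2)).toReal

namespace IsLaplaceFamily

variable {u : EuclideanSpace ℝ (Fin n) × ℝ → ℝ} {ν : EuclideanSpace ℝ (Fin n) → Measure ℝ}

lemma real_univ (h : IsLaplaceFamily u ν) (x : EuclideanSpace ℝ (Fin n)) :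
    (ν x).real univ = u (x, 0) := by
  have := h.isFiniteMeasure x
  refine tendsto_nhds_unique (tendsto_integral_exp_neg (h.Iio_zero x)) ?_
  have hc : Continuous fun τ : ℝ => u (x, -τ) := h.heat.1.continuous.comp (by fun_prop)
  have h0 := (hc.tendsto 0).mono_left (nhdsWithin_le_nhds (s := Ioi 0))
  rw [neg_zero] at h0
  refine h0.congr' ?_
  filter_upwards [self_mem_nhdsWithin] with τ hτ using h.eq_integral x τ hτ

lemma iterate_timeDeriv_eq (h : IsLaplaceFamily u ν) (k : ℕ) (x : EuclideanSpace ℝ (Fin n)) {t : ℝ}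
    (ht : t < 0) : timeDeriv^[k] u (x, t) = ∫ s, s ^ k * exp (t * s) ∂ν x := by
  have := h.isFiniteMeasure x
  induction k generalizing t with
  | zero => simpa using h.eq_integral x (-t) (by linarith)
  | succ k ih =>
    rw [Function.iterate_succ_apply']
    refine (hasDerivAt_timeDeriv (iterate_timeDeriv h.heat k).1 x t).unique ?_
    refine (hasDerivAt_integral_pow_mul_exp (h.Iio_zero x) ht k).congr_of_eventuallyEq ?_
    filter_upwards [Iio_mem_nhds ht] with r hr using ih hr

lemma measurable (h : IsLaplaceFamily u ν) : Measurable ν := by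
  have := h.isFiniteMeasure
  refine .measure_of_isPiSystem (borel_eq_generateFrom_Iic ℝ) isPiSystem_Iic ?_ ?_
  · rintro _ ⟨t, rfl⟩
    have hIic (x : EuclideanSpace ℝ (Fin n)) :
        ν x (Iic t) = ENNReal.ofReal ((ν x (Icc 0 t)).toReal) := by
      rw [ENNReal.ofReal_toReal (measure_ne_top _ _)]
      refine measure_congr ?_
      filter_upwards [ae_nonneg_of_Iio_eq_zero (h.Iio_zero x)] with s hs
      exact propext ⟨fun hst => ⟨hs, hst⟩, fun hst => hst.2⟩
    simp_rw [hIic]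
    exact (h.measurable_Icc.comp measurable_prodMk_right).ennreal_ofReal
  · have huniv (x : EuclideanSpace ℝ (Fin n)) : ν x univ = ENNReal.ofReal (u (x, 0)) := by
      rw [← h.real_univ x, ofReal_measureReal]
    simp_rw [huniv]
    have hc : Continuous fun x : EuclideanSpace ℝ (Fin n) => u (x, 0) :=
      h.heat.1.continuous.comp (by fun_prop)
    exact hc.measurable.ennreal_ofReal

lemma hasSum_moments (h : IsLaplaceFamily u ν) (j : ℕ) (x : EuclideanSpace ℝ (Fin n)) {τ : ℝ}
    (hτ : 0 < τ) :
    HasSum (fun k => ballMass n (j + 1 + k) / (4 ^ k * k.factorial) *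
        ∫ s, s ^ k * exp (-(τ * s)) ∂ν x)
      (∫ y, ballKernel (j + 1) y * u (x + y, -τ)) := by
  have hf := h.isFiniteMeasure
  have hτ' : -τ < 0 := neg_lt_zero.2 hτ
  have hv (k : ℕ) (y : EuclideanSpace ℝ (Fin n)) :
      timeDeriv^[k] u (y, -τ) = ∫ s, s ^ k * exp (-(τ * s)) ∂ν y := by
    rw [h.iterate_timeDeriv_eq k y hτ']
    simp only [neg_mul]
  have hc : Continuous fun y : EuclideanSpace ℝ (Fin n) => u (y, 0) :=
    h.heat.1.continuous.comp (by fun_prop)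
  obtain ⟨C, hC⟩ := (isCompact_closedBall x 1).exists_bound_of_continuousOn hc.continuousOn
  have key := hasSum_ballKernel_expansion (v := fun k y => timeDeriv^[k] u (y, -τ)) (C := C) j
    (fun k => (show ContDiff ℝ 2 (timeDeriv^[k] u) from
      mod_cast contDiff_infty.1 (iterate_timeDeriv h.heat k).1 2).comp
      (by fun_prop : ContDiff ℝ 2 fun y : EuclideanSpace ℝ (Fin n) => (y, -τ)))
    (fun k y => (iterate_timeDeriv h.heat k).2 y _ hτ') x
    (fun k => (integral_pow_mul_exp_neg_nonneg (h.Iio_zero x) τ k).trans_eq (hv k x).symm) hτ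
    (fun k y hy => ?_)
  · simp_rw [← hv]
    exact key
  · rw [hv, abs_of_nonneg (integral_pow_mul_exp_neg_nonneg (h.Iio_zero _) τ k)]
    refine (integral_pow_mul_exp_neg_le (h.Iio_zero _) hτ k).trans ?_
    rw [h.real_univ]
    gcongr
    exact (le_abs_self _).trans (hC _ (by simpa using hy))

lemma bind_ballKernel (h : IsLaplaceFamily u ν) (j : ℕ) (x : EuclideanSpace ℝ (Fin n)) :
    (volume.withDensity fun y : EuclideanSpace ℝ (Fin n) =>
        ENNReal.ofReal (ballKernel (j + 1) y)).bind (fun y => ν (x + y))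
      = (ν x).withDensity fun s => ENNReal.ofReal (ballSymbol n (j + 1) s) := by
  have hf := h.isFiniteMeasure
  have hνm : Measurable fun y => ν (x + y) := h.measurable.comp (measurable_const_add x)
  have hexp (τ : ℝ) : Measurable fun s => ENNReal.ofReal (exp (-(τ * s))) := by fun_prop
  have hL {τ : ℝ} (hτ : 0 < τ) : ∫⁻ s, ENNReal.ofReal (exp (-(τ * s)))
      ∂((volume.withDensity fun y : EuclideanSpace ℝ (Fin n) =>
        ENNReal.ofReal (ballKernel (j + 1) y)).bind (fun y => ν (x + y)))
      = ENNReal.ofReal (∫ y, ballKernel (j + 1) y * u (x + y, -τ)) := by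
    have hu0 (y : EuclideanSpace ℝ (Fin n)) : 0 ≤ u (x + y, -τ) := by
      rw [h.eq_integral _ _ hτ]
      exact integral_nonneg fun _ => (exp_pos _).le
    have hcu : Continuous fun y : EuclideanSpace ℝ (Fin n) => u (x + y, -τ) :=
      h.heat.1.continuous.comp (by fun_prop)
    have hm : Measurable fun y => ∫⁻ s, ENNReal.ofReal (exp (-(τ * s))) ∂ν (x + y) :=
      (Measure.measurable_lintegral (hexp τ)).comp hνm
    rw [Measure.lintegral_bind hνm.aemeasurable (hexp τ).aemeasurable,
      lintegral_withDensity_eq_lintegral_mul _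
        (continuous_ballKernel _).measurable.ennreal_ofReal hm,
      ofReal_integral_eq_lintegral_ofReal (integrable_ballKernel_mul j hcu)
        (ae_of_all _ fun y => mul_nonneg (ballKernel_nonneg _ _) (hu0 y))]
    refine lintegral_congr fun y => ?_
    have hi : Integrable (fun s => exp (-(τ * s))) (ν (x + y)) := by
      simpa using integrable_pow_mul_exp_neg (h.Iio_zero (x + y)) hτ 0
    rw [Pi.mul_apply, ENNReal.ofReal_mul (ballKernel_nonneg _ _), h.eq_integral _ _ hτ,
      ofReal_integral_eq_lintegral_ofReal hi (ae_of_all _ fun _ => (exp_pos _).le)]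
  refine Measure.ext_of_laplace_eq (fun τ hτ => ?_) (fun τ hτ => ?_)
  · rw [hL hτ]
    exact ENNReal.ofReal_ne_top
  have hc (k : ℕ) : 0 ≤ ballMass n (j + 1 + k) / (4 ^ k * k.factorial) := by
    have : 0 < ballMass n (j + 1 + k) := by rw [add_right_comm]; exact ballMass_pos _
    positivity
  have hsum := h.hasSum_moments j x hτ
  rw [hL hτ, ← hsum.tsum_eq, lintegral_withDensity_eq_lintegral_mul _
    (measurable_ballSymbol j).ennreal_ofReal (hexp τ),
    ENNReal.ofReal_tsum_of_nonneg (fun k => mul_nonneg (hc k)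
      (integral_pow_mul_exp_neg_nonneg (h.Iio_zero x) τ k)) hsum.summable]
  have hterm (k : ℕ) : ENNReal.ofReal (ballMass n (j + 1 + k) / (4 ^ k * k.factorial) *
        ∫ s, s ^ k * exp (-(τ * s)) ∂ν x)
      = ∫⁻ s, ENNReal.ofReal (ballMass n (j + 1 + k) / (4 ^ k * k.factorial) *
        (s ^ k * exp (-(τ * s)))) ∂ν x := by
    rw [← integral_const_mul, ofReal_integral_eq_lintegral_ofReal
      ((integrable_pow_mul_exp_neg (h.Iio_zero x) hτ k).const_mul _)]
    filter_upwards [ae_nonneg_of_Iio_eq_zero (h.Iio_zero x)] with s hs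
    exact mul_nonneg (hc k) (by positivity)
  simp_rw [hterm]
  rw [← lintegral_tsum fun k => by fun_prop]
  refine lintegral_congr_ae ?_
  filter_upwards [ae_nonneg_of_Iio_eq_zero (h.Iio_zero x)] with s hs
  have hS := (summable_ballSymbol (n := n) j s).mul_right (exp (-(τ * s)))
  simp only [mul_assoc] at hS
  rw [← ENNReal.ofReal_tsum_of_nonneg (fun k => mul_nonneg (hc k) (by positivity)) hS,
    Pi.mul_apply, ← ENNReal.ofReal_mul (ballSymbol_pos j hs).le, ballSymbol, ← tsum_mul_right]
  simp only [mul_assoc]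

lemma lintegral_ballKernel_mul (h : IsLaplaceFamily u ν) (j : ℕ) (x : EuclideanSpace ℝ (Fin n))
    {g : ℝ → ENNReal} (hg : Measurable g) :
    ∫⁻ y, ENNReal.ofReal (ballKernel (j + 1) y) * ∫⁻ s, g s ∂ν (x + y)
      = ∫⁻ s, ENNReal.ofReal (ballSymbol n (j + 1) s) * g s ∂ν x := by
  have hνm : Measurable fun y => ν (x + y) := h.measurable.comp (measurable_const_add x)
  have hm : Measurable fun y => ∫⁻ s, g s ∂ν (x + y) := (Measure.measurable_lintegral hg).comp hνm
  have key := congrArg (fun μ => ∫⁻ s, g s ∂μ) (h.bind_ballKernel j x)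
  rwa [Measure.lintegral_bind hνm.aemeasurable hg.aemeasurable,
    lintegral_withDensity_eq_lintegral_mul _ (continuous_ballKernel _).measurable.ennreal_ofReal hm,
    lintegral_withDensity_eq_lintegral_mul _ (measurable_ballSymbol j).ennreal_ofReal hg] at key

section Weight

variable {g : ℝ → ℝ} {B t : ℝ}

lemma ofReal_setIntegral (h : IsLaplaceFamily u ν) (hg : Measurable g)
    (hg0 : ∀ s ∈ Icc 0 t, 0 ≤ g s) (hgB : ∀ s ∈ Icc 0 t, g s ≤ B) (y : EuclideanSpace ℝ (Fin n)) :
    ENNReal.ofReal (∫ s in Icc 0 t, g s ∂ν y) = ∫⁻ s in Icc 0 t, ENNReal.ofReal (g s) ∂ν y := by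
  have := h.isFiniteMeasure y
  refine ofReal_integral_eq_lintegral_ofReal ?_ (ae_restrict_of_forall_mem measurableSet_Icc hg0)
  refine Integrable.of_bound hg.aestronglyMeasurable B
    (ae_restrict_of_forall_mem measurableSet_Icc fun s hs => ?_)
  rw [Real.norm_of_nonneg (hg0 s hs)]
  exact hgB s hs

lemma measurable_setIntegral (h : IsLaplaceFamily u ν) (hg : Measurable g)
    (hg0 : ∀ s ∈ Icc 0 t, 0 ≤ g s) (hgB : ∀ s ∈ Icc 0 t, g s ≤ B) :
    Measurable fun y => ∫ s in Icc 0 t, g s ∂ν y := by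
  have heq : (fun y => ∫ s in Icc 0 t, g s ∂ν y)
      = fun y => (∫⁻ s, (Icc 0 t).indicator (fun s => ENNReal.ofReal (g s)) s ∂ν y).toReal := by
    ext y
    rw [lintegral_indicator measurableSet_Icc, ← h.ofReal_setIntegral hg hg0 hgB,
      ENNReal.toReal_ofReal (setIntegral_nonneg measurableSet_Icc hg0)]
  rw [heq]
  exact ((Measure.measurable_lintegral (hg.ennreal_ofReal.indicator measurableSet_Icc)).comp
    h.measurable).ennreal_toReal

lemma locallyIntegrable_setIntegral (h : IsLaplaceFamily u ν) (hg : Measurable g)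
    (hg0 : ∀ s ∈ Icc 0 t, 0 ≤ g s) (hgB : ∀ s ∈ Icc 0 t, g s ≤ B) :
    LocallyIntegrable (fun y => ∫ s in Icc 0 t, g s ∂ν y) := by
  have hc : Continuous fun y : EuclideanSpace ℝ (Fin n) => u (y, 0) :=
    h.heat.1.continuous.comp (by fun_prop)
  refine (hc.const_mul |B|).locallyIntegrable.mono
    (h.measurable_setIntegral hg hg0 hgB).aestronglyMeasurable (ae_of_all _ fun y => ?_)
  have := h.isFiniteMeasure y
  rw [← h.real_univ, norm_mul, Real.norm_eq_abs |B|, abs_abs, Real.norm_of_nonneg measureReal_nonneg]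
  refine (norm_setIntegral_le_of_norm_le_const (C := |B|) (measure_lt_top _ _) fun s hs => ?_).trans
    (mul_le_mul_of_nonneg_left (measureReal_mono (subset_univ _)) (abs_nonneg _))
  rw [Real.norm_of_nonneg (hg0 s hs)]
  exact (hgB s hs).trans (le_abs_self _)

lemma integral_ballKernel_mul_setIntegral (h : IsLaplaceFamily u ν) (hg : Measurable g)
    (hg0 : ∀ s ∈ Icc 0 t, 0 ≤ g s) (hgB : ∀ s ∈ Icc 0 t, g s ≤ B) (j : ℕ)
    (x : EuclideanSpace ℝ (Fin n)) :
    ∫ y, ballKernel (j + 1) y * ∫ s in Icc 0 t, g s ∂ν (x + y)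
      = ∫ s in Icc 0 t, ballSymbol n (j + 1) s * g s ∂ν x := by
  have hF0 (y : EuclideanSpace ℝ (Fin n)) : 0 ≤ ∫ s in Icc 0 t, g s ∂ν y :=
    setIntegral_nonneg measurableSet_Icc hg0
  have hFm := h.measurable_setIntegral hg hg0 hgB
  rw [integral_eq_lintegral_of_nonneg_ae
      (ae_of_all _ fun y => mul_nonneg (ballKernel_nonneg _ _) (hF0 _))
      ((continuous_ballKernel _).measurable.mul
        (hFm.comp (measurable_const_add x))).aestronglyMeasurable,
    integral_eq_lintegral_of_nonneg_ae
      (ae_restrict_of_forall_mem measurableSet_Icc fun s hs =>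
        mul_nonneg (ballSymbol_pos j hs.1).le (hg0 s hs))
      ((measurable_ballSymbol j).mul hg).aestronglyMeasurable]
  congr 1
  calc ∫⁻ y, ENNReal.ofReal (ballKernel (j + 1) y * ∫ s in Icc 0 t, g s ∂ν (x + y))
      = ∫⁻ y, ENNReal.ofReal (ballKernel (j + 1) y) *
          ∫⁻ s, (Icc 0 t).indicator (fun s => ENNReal.ofReal (g s)) s ∂ν (x + y) := by
        refine lintegral_congr fun y => ?_
        rw [ENNReal.ofReal_mul (ballKernel_nonneg _ _), h.ofReal_setIntegral hg hg0 hgB,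
          lintegral_indicator measurableSet_Icc]
    _ = ∫⁻ s in Icc 0 t, ENNReal.ofReal (ballSymbol n (j + 1) s * g s) ∂ν x := by
        rw [h.lintegral_ballKernel_mul j x (hg.ennreal_ofReal.indicator measurableSet_Icc),
          ← lintegral_indicator measurableSet_Icc]
        refine lintegral_congr fun s => ?_
        by_cases hs : s ∈ Icc 0 t
        · simp only [indicator_of_mem hs]
          rw [ENNReal.ofReal_mul (ballSymbol_pos j hs.1).le]
        · simp only [indicator_of_notMem hs, mul_zero]

end Weight

/-! ### Smoothness and the Laplacian of the distribution functions -/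

lemma inv_ballSymbol_le (j : ℕ) {s : ℝ} (hs : 0 ≤ s) :
    (ballSymbol n (j + 1) s)⁻¹ ≤ (ballMass n (j + 1))⁻¹ :=
  inv_anti₀ (ballMass_pos j) (ballMass_le_ballSymbol j hs)

lemma locallyIntegrable_inv_ballSymbol (h : IsLaplaceFamily u ν) (j : ℕ) (t : ℝ) :
    LocallyIntegrable fun y => ∫ s in Icc 0 t, (ballSymbol n (j + 1) s)⁻¹ ∂ν y :=
  h.locallyIntegrable_setIntegral (measurable_ballSymbol j).inv
    (fun _ hs => (inv_pos.2 (ballSymbol_pos j hs.1)).le) fun _ hs => inv_ballSymbol_le j hs.1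

open scoped Convolution in
lemma convolution_ballKernel (h : IsLaplaceFamily u ν) (i j : ℕ) (t : ℝ)
    (x : EuclideanSpace ℝ (Fin n)) :
    ((fun y => ∫ s in Icc 0 t, (ballSymbol n (j + 1) s)⁻¹ ∂ν y)
        ⋆[ContinuousLinearMap.mul ℝ ℝ] ballKernel (i + 1)) x
      = ∫ s in Icc 0 t, ballSymbol n (i + 1) s * (ballSymbol n (j + 1) s)⁻¹ ∂ν x := by
  have hm : Measurable fun s => (ballSymbol n (j + 1) s)⁻¹ := (measurable_ballSymbol j).inv
  rw [← h.integral_ballKernel_mul_setIntegral hm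
    (fun _ hs => (inv_pos.2 (ballSymbol_pos j hs.1)).le) (fun _ hs => inv_ballSymbol_le j hs.1),
    convolution_def, ← integral_add_left_eq_self _ x]
  refine integral_congr_ae (ae_of_all _ fun y => ?_)
  simp only [ContinuousLinearMap.mul_apply', sub_add_cancel_left, ballKernel_neg]
  exact mul_comm _ _

open scoped Convolution in
lemma real_Icc_eq_convolution (h : IsLaplaceFamily u ν) (j : ℕ) (t : ℝ) :
    (fun x => (ν x (Icc 0 t)).toReal) =
      (fun y => ∫ s in Icc 0 t, (ballSymbol n (j + 1) s)⁻¹ ∂ν y)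
        ⋆[ContinuousLinearMap.mul ℝ ℝ] ballKernel (j + 1) := by
  ext x
  rw [h.convolution_ballKernel, setIntegral_congr_fun (g := fun _ => 1) measurableSet_Icc
    fun s hs => mul_inv_cancel₀ (ballSymbol_pos j hs.1).ne']
  simp [measureReal_def]

lemma contDiff_real_Icc (h : IsLaplaceFamily u ν) (t : ℝ) :
    ContDiff ℝ (⊤ : ℕ∞) fun x => (ν x (Icc 0 t)).toReal := by
  refine contDiff_infty.2 fun j => ?_
  rw [h.real_Icc_eq_convolution j t]
  exact (hasCompactSupport_ballKernel j).contDiff_convolution_right _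
    (h.locallyIntegrable_inv_ballSymbol j t) (contDiff_ballKernel j)

end IsLaplaceFamily

open scoped Convolution in
lemma fderiv_convolution_apply {f g : EuclideanSpace ℝ (Fin n) → ℝ} (hf : LocallyIntegrable f)
    (hcg : HasCompactSupport g) (hg : ContDiff ℝ 1 g) (x w : EuclideanSpace ℝ (Fin n)) :
    fderiv ℝ (f ⋆[ContinuousLinearMap.mul ℝ ℝ] g) x w
      = (f ⋆[ContinuousLinearMap.mul ℝ ℝ] fun y => fderiv ℝ g y w) x := by
  rw [(hcg.hasFDerivAt_convolution_right _ hf hg x).fderiv,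
    convolution_precompR_apply _ hf (hcg.fderiv ℝ) (hg.continuous_fderiv one_ne_zero)]

open scoped Convolution in
lemma lap_convolution {f g : EuclideanSpace ℝ (Fin n) → ℝ} (hf : LocallyIntegrable f)
    (hcg : HasCompactSupport g) (hg : ContDiff ℝ 2 g) (x : EuclideanSpace ℝ (Fin n)) :
    lap n (f ⋆[ContinuousLinearMap.mul ℝ ℝ] g) x
      = (f ⋆[ContinuousLinearMap.mul ℝ ℝ] lap n g) x := by
  have hg1 (w : EuclideanSpace ℝ (Fin n)) : ContDiff ℝ 1 fun y => fderiv ℝ g y w :=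
    (hg.fderiv_right (by norm_num)).clm_apply contDiff_const
  have hcg1 (w : EuclideanSpace ℝ (Fin n)) : HasCompactSupport fun y => fderiv ℝ g y w :=
    hcg.fderiv_apply ℝ w
  simp only [lap, fderiv_convolution_apply hf hcg (hg.of_le one_le_two),
    fderiv_convolution_apply hf (hcg1 _) (hg1 _)]
  have hint (i : Fin n) := ((hcg1 (EuclideanSpace.single i 1)).fderiv_apply ℝ
    (EuclideanSpace.single i 1)).convolutionExists_right (ContinuousLinearMap.mul ℝ ℝ) hf
      (((hg1 _).continuous_fderiv one_ne_zero).clm_apply continuous_const) x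
  simp only [convolution_def]
  rw [← integral_finsetSum _ fun i _ => hint i]
  simp only [ContinuousLinearMap.mul_apply', Finset.mul_sum, lap]

lemma ballSymbol_mono (j : ℕ) {s t : ℝ} (hs : 0 ≤ s) (hst : s ≤ t) :
    ballSymbol n (j + 1) s ≤ ballSymbol n (j + 1) t := by
  refine (summable_ballSymbol j s).tsum_le_tsum (fun k => ?_) (summable_ballSymbol j t)
  have : 0 < ballMass n (j + 1 + k) := by rw [add_right_comm]; exact ballMass_pos _
  gcongr

lemma integrableOn_ballSymbol_div {μ : Measure ℝ} [IsFiniteMeasure μ] (i j : ℕ) (t : ℝ) :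
    IntegrableOn (fun s => ballSymbol n (i + 1) s * (ballSymbol n (j + 1) s)⁻¹) (Icc 0 t) μ := by
  refine Integrable.of_bound
    ((measurable_ballSymbol i).mul (measurable_ballSymbol j).inv).aestronglyMeasurable
    (ballSymbol n (i + 1) t * (ballMass n (j + 1))⁻¹)
    (ae_restrict_of_forall_mem measurableSet_Icc fun s hs => ?_)
  have hi := ballSymbol_pos (n := n) i hs.1
  have hj := ballSymbol_pos (n := n) j hs.1
  rw [Real.norm_of_nonneg (by positivity)]
  exact mul_le_mul (ballSymbol_mono i hs.1 hs.2) (IsLaplaceFamily.inv_ballSymbol_le j hs.1)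
    (by positivity) (hi.le.trans (ballSymbol_mono i hs.1 hs.2))

open scoped Convolution in
lemma IsLaplaceFamily.lap_real_Icc {u : EuclideanSpace ℝ (Fin n) × ℝ → ℝ}
    {ν : EuclideanSpace ℝ (Fin n) → Measure ℝ} (h : IsLaplaceFamily u ν) (t : ℝ)
    (x : EuclideanSpace ℝ (Fin n)) :
    lap n (fun y => (ν y (Icc 0 t)).toReal) x = ∫ s in Icc 0 t, s ∂ν x := by
  have := h.isFiniteMeasure x
  have hf := h.locallyIntegrable_inv_ballSymbol 2 t
  have hex (i : ℕ) (c : ℝ) : ConvolutionExistsAt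
      (fun y => ∫ s in Icc 0 t, (ballSymbol n (2 + 1) s)⁻¹ ∂ν y) (c • ballKernel (i + 1)) x
      (ContinuousLinearMap.mul ℝ ℝ) volume := ((hasCompactSupport_ballKernel (n := n) i).smul_left
    (f := fun _ => c)).convolutionExists_right (ContinuousLinearMap.mul ℝ ℝ) hf
      ((continuous_ballKernel _).const_smul c) x
  set c : ℝ := 2 * n + 4 * ((0 : ℕ) + 2)
  have hlap : lap n (ballKernel 3) =
      (4 : ℝ) • ballKernel (n := n) (0 + 1) + (-c) • ballKernel (1 + 1) := by
    ext y
    rw [lap_ballKernel 0 y, Pi.add_apply, Pi.smul_apply, Pi.smul_apply, smul_eq_mul, smul_eq_mul,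
      neg_mul, ← sub_eq_add_neg]
  rw [h.real_Icc_eq_convolution 2 t,
    lap_convolution hf (hasCompactSupport_ballKernel 2) (mod_cast contDiff_ballKernel 2), hlap,
    (hex 0 4).distrib_add (hex 1 (-c)), convolution_smul, convolution_smul,
    Pi.smul_apply, Pi.smul_apply, h.convolution_ballKernel, h.convolution_ballKernel, smul_eq_mul,
    smul_eq_mul, ← integral_const_mul, ← integral_const_mul,
    ← integral_add ((integrableOn_ballSymbol_div 0 2 t).const_mul 4)
      ((integrableOn_ballSymbol_div 1 2 t).const_mul (-c))]
  refine setIntegral_congr_fun measurableSet_Icc fun s hs => ?_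
  have h3 := ballSymbol_succ (n := n) 0 s
  have hpos := (ballSymbol_pos (n := n) 2 hs.1).ne'
  simp only [zero_add, Nat.reduceAdd] at h3 hpos ⊢
  field_simp
  linear_combination h3

end

/-- if `u` is a nonnegative ancient solution of the heat equation on
`ℝⁿ × (-∞, 0]`, `(ν_x)` is a family of finite nonnegative Borel measures on `[0,∞)`
with `u(x,-t) = ∫₀^∞ e^{-ts} dν_x(s)` for `t > 0`, and `h(x,t) = ν_x([0,t])` is jointly
measurable, then for each `t ≥ 0` the function `x ↦ h(x,t)` is smooth and satisfies
`Δ_x h(x,t) = t h(x,t) − ∫₀^t h(x,s) ds`. -/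
theorem ancient_nonneg_heat_measure_family_elliptic (n : ℕ)
    (u : EuclideanSpace ℝ (Fin n) × ℝ → ℝ)
    (hu : IsAncientHeat n u)
    (hnonneg : ∀ (x : EuclideanSpace ℝ (Fin n)) (t : ℝ), t ≤ 0 → 0 ≤ u (x, t))
    (ν : EuclideanSpace ℝ (Fin n) → Measure ℝ)
    (hfin : ∀ x, IsFiniteMeasure (ν x))
    (hsupp : ∀ x, ν x (Set.Iio 0) = 0)
    (hrep : ∀ (x : EuclideanSpace ℝ (Fin n)) (t : ℝ), 0 < t →
      u (x, -t) = ∫ s, Real.exp (-(t * s)) ∂ν x)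
    (hmeas : Measurable (fun p : EuclideanSpace ℝ (Fin n) × ℝ =>
      (ν p.1 (Set.Icc 0 p.2)).toReal)) :
    ∀ t : ℝ, 0 ≤ t →
      ContDiff ℝ (⊤ : ℕ∞) (fun x => (ν x (Set.Icc 0 t)).toReal) ∧
      ∀ x : EuclideanSpace ℝ (Fin n),
        lap n (fun y => (ν y (Set.Icc 0 t)).toReal) x
          = t * (ν x (Set.Icc 0 t)).toReal
            - ∫ s in Set.Icc (0 : ℝ) t, (ν x (Set.Icc 0 s)).toReal := by
  have h : IsLaplaceFamily u ν := ⟨hu, hfin, hsupp, hrep, hmeas⟩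
  intro t _
  refine ⟨h.contDiff_real_Icc t, fun x => ?_⟩
  have := hfin x
  rw [h.lap_real_Icc t x, setIntegral_id_eq]
  rfl
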